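/- arXiv:2109.05655 — 2 statements merged into one kernel-verified Lean document; each statement's English description precedes it below -/
import Mathlib

section
/- Let n ≥ 0 and let C and D be elements of the n-qubit real Clifford group C_n. If C P C⁻¹ = D P D⁻¹ for every P in the n-qubit real Pauli group P_n, then C = D or C = −D. -/
open Matrix

noncomputable section

namespace RealStab

abbrev Mat (n : ℕ) := Matrix (Fin n → Fin 2) (Fin n → Fin 2) ℝ

/-- The real Pauli matrix `X`. -/
def X2 : Matrix (Fin 2) (Fin 2) ℝ := !![0, 1; 1, 0]

/-- The real Pauli matrix `Z`. -/
def Z2 : Matrix (Fin 2) (Fin 2) ℝ := !![1, 0; 0, -1]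

/-- The set `{I, X, Z, XZ}` of single-qubit Pauli matrices. -/
def pauliSet : Set (Matrix (Fin 2) (Fin 2) ℝ) := {1, X2, Z2, X2 * Z2}

/-- The `n`-fold Kronecker (tensor) product `P 0 ⊗ ⋯ ⊗ P (n-1)`, represented as a
matrix indexed by functions `Fin n → Fin 2` (a `2^n × 2^n` matrix). -/
def tensorN {n : ℕ} (P : Fin n → Matrix (Fin 2) (Fin 2) ℝ) : Mat n :=
  Matrix.of fun x y => ∏ i, P i (x i) (y i)

/-- The `n`-qubit real Pauli group `P_n`, as a set of `2^n × 2^n` real matrices. -/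
def PauliGroup (n : ℕ) : Set (Mat n) :=
  { M | ∃ a : Fin 2, ∃ P : Fin n → Matrix (Fin 2) (Fin 2) ℝ,
      (∀ i, P i ∈ pauliSet) ∧ M = (-1 : ℝ) ^ (a : ℕ) • tensorN P }


/-- The `n`-qubit real Clifford group `C_n`: orthogonal matrices normalizing `P_n`. -/
def CliffordGroup (n : ℕ) : Set (Mat n) :=
  { U | U ∈ Matrix.orthogonalGroup (Fin n → Fin 2) ℝ ∧
        ∀ P ∈ PauliGroup n, U * P * U⁻¹ ∈ PauliGroup n }

theorem tensorN_mem_pauliGroup {n : ℕ} {P : Fin n → Matrix (Fin 2) (Fin 2) ℝ}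
    (hP : ∀ i, P i ∈ pauliSet) : tensorN P ∈ PauliGroup n :=
  ⟨0, P, hP, by simp⟩

/-- The Pauli matrix acting as `Z` on qubit `i` and trivially elsewhere is diagonal. -/
theorem tensorN_single_Z2 {n : ℕ} (i : Fin n) :
    tensorN (fun j => if j = i then Z2 else 1) =
      diagonal fun x : Fin n → Fin 2 => Z2 (x i) (x i) := by
  ext x y
  simp only [tensorN, of_apply, diagonal_apply]
  split_ifs with hxy
  · subst hxy
    rw [Finset.prod_eq_single i] <;> simp +contextual
  · obtain ⟨j, hj⟩ := Function.ne_iff.mp hxy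
    refine Finset.prod_eq_zero (Finset.mem_univ j) ?_
    split_ifs
    · generalize x j = a at *
      generalize y j = b at *
      fin_cases a <;> fin_cases b <;> simp_all [Z2]
    · exact one_apply_ne hj

theorem tensorN_flip_apply {n : ℕ} (x y : Fin n → Fin 2) :
    tensorN (fun i => if x i = y i then 1 else X2) x y = 1 := by
  simp only [tensorN, of_apply]
  refine Finset.prod_eq_one fun i _ => ?_
  generalize x i = a
  generalize y i = b
  fin_cases a <;> fin_cases b <;> simp [X2]

/-- Schur's lemma for the real Pauli group: its commutant consists of scalar matrices. -/
theorem exists_eq_smul_one_of_commute {n : ℕ} {A : Mat n}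
    (hA : ∀ P ∈ PauliGroup n, Commute A P) : ∃ c : ℝ, A = c • 1 := by
  have offDiag (x y : Fin n → Fin 2) (hxy : x ≠ y) : A x y = 0 := by
    obtain ⟨i, hi⟩ := Function.ne_iff.mp hxy
    have hcomm := hA _ (tensorN_mem_pauliGroup
      (P := fun j => if j = i then Z2 else 1) fun j => by
        split_ifs <;> simp [pauliSet])
    rw [tensorN_single_Z2] at hcomm
    have hentry := congrFun₂ hcomm.eq x y
    rw [mul_diagonal, diagonal_mul] at hentry
    have hZ : Z2 (y i) (y i) - Z2 (x i) (x i) ≠ 0 := by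
      revert hi
      generalize x i = a
      generalize y i = b
      fin_cases a <;> fin_cases b <;> norm_num [Z2]
    exact (mul_eq_zero.mp (by linear_combination hentry :
      (Z2 (y i) (y i) - Z2 (x i) (x i)) * A x y = 0)).resolve_left hZ
  have diag_eq (x y : Fin n → Fin 2) : A x x = A y y := by
    have hcomm := hA _ (tensorN_mem_pauliGroup
      (P := fun i => if x i = y i then 1 else X2) fun i => by
        split_ifs <;> simp [pauliSet])
    have hentry := congrFun₂ hcomm.eq x y
    rw [mul_apply, mul_apply,
      Finset.sum_eq_single x (fun z _ hz => by rw [offDiag x z hz.symm, zero_mul]) (by simp),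
      Finset.sum_eq_single y (fun z _ hz => by rw [offDiag z y hz, mul_zero]) (by simp),
      tensorN_flip_apply] at hentry
    simpa using hentry
  refine ⟨A 0 0, ?_⟩
  ext x y
  by_cases hxy : x = y
  · subst hxy
    simpa using diag_eq x 0
  · simpa [one_apply_ne hxy] using offDiag x y hxy

/-- If `C, D ∈ C_n` act identically on `P_n` by conjugation,
then `C = D` or `C = −D`. -/
theorem clifford_eq_up_to_sign (n : ℕ) (C D : Mat n)
    (hC : C ∈ CliffordGroup n) (hD : D ∈ CliffordGroup n)
    (h : ∀ P ∈ PauliGroup n, C * P * C⁻¹ = D * P * D⁻¹) :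
    C = D ∨ C = -D := by
  have isUnit_det {U : Mat n} (hU : U ∈ CliffordGroup n) : IsUnit U.det :=
    (isUnit_iff_isUnit_det U).mp (IsUnit.of_mul_eq_one _ (mem_orthogonalGroup_iff _ _ |>.mp hU.1))
  have hCdet := isUnit_det hC
  have hDdet := isUnit_det hD
  obtain ⟨c, hc⟩ := exists_eq_smul_one_of_commute (A := D⁻¹ * C) fun P hP => by
    calc D⁻¹ * C * P = D⁻¹ * (C * P * C⁻¹) * C := by
          simp only [mul_assoc, nonsing_inv_mul _ hCdet, mul_one]
      _ = D⁻¹ * (D * P * D⁻¹) * C := by rw [h P hP]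
      _ = P * (D⁻¹ * C) := by
          simp only [← mul_assoc, nonsing_inv_mul _ hDdet, one_mul]
  have hCD : C = c • D := by
    rw [← mul_nonsing_inv_cancel_left D C hDdet, hc, Matrix.mul_smul, mul_one]
  have hsq : c * c = 1 := by
    have hCC := (mem_orthogonalGroup_iff _ _).mp hC.1
    rw [hCD, transpose_smul, smul_mul_smul_comm, (mem_orthogonalGroup_iff _ _).mp hD.1] at hCC
    simpa using congrFun₂ hCC 0 0
  rcases mul_self_eq_one_iff.mp hsq with rfl | rfl
  · exact Or.inl (by simpa using hCD)
  · exact Or.inr (by simpa using hCD)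

end RealStab

end
end

section
/- Let n ≥ 1 and let Q be an element of the n-qubit real Pauli group P_n with Q² = I such that Q anticommutes with Z ⊗ I ⊗ ⋯ ⊗ I (i.e., Q(Z ⊗ I^{⊗(n−1)}) = −(Z ⊗ I^{⊗(n−1)})Q). Then there exists U in the gate group G_n such that U Q U⁻¹ = I ⊗ ⋯ ⊗ I ⊗ X and U (Z ⊗ I ⊗ ⋯ ⊗ I) U⁻¹ = I ⊗ ⋯ ⊗ I ⊗ Z (with X, respectively Z, in the last tensor factor and the 2×2 identity in the remaining n−1 factors). -/
open Matrix

noncomputable section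

namespace RealStab

/-- The Hadamard matrix `H = (1/√2)·!![1,1;1,−1]`. -/
def Hmat : Matrix (Fin 2) (Fin 2) ℝ := (Real.sqrt 2)⁻¹ • !![1, 1; 1, -1]

/-- The single-qubit gate `G` applied on qubit `i`: the Kronecker product
`I^{⊗(i-1)} ⊗ G ⊗ I^{⊗(n-i)}`. -/
def gate1 {n : ℕ} (i : Fin n) (G : Matrix (Fin 2) (Fin 2) ℝ) : Mat n :=
  tensorN (fun j => if j = i then G else 1)

/-- The controlled-Z gate on qubits `i` and `j`: diagonal, with entry `−1` exactly
on basis states where both bits `i` and `j` equal `1`. For `j = i+1` this is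
`I^{⊗(i-1)} ⊗ CZ ⊗ I^{⊗(n-i-1)}` with `CZ = diag(1,1,1,−1)`. -/
def CZgate {n : ℕ} (i j : Fin n) : Mat n :=
  Matrix.diagonal (fun x => if x i = 1 ∧ x j = 1 then -1 else 1)

/-- The set of generating gate matrices: `H`-gates and `Z`-gates on each qubit, and
`CZ`-gates on adjacent pairs of qubits. -/
def gateSet (n : ℕ) : Set (Mat n) :=
  { M | (∃ i : Fin n, M = gate1 i Hmat) ∨ (∃ i : Fin n, M = gate1 i Z2) ∨
        (∃ i : Fin n, ∃ h : (i : ℕ) + 1 < n, M = CZgate i ⟨(i : ℕ) + 1, h⟩) }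

/-- The gate group `G_n`: the subgroup of `GL(2^n, ℝ)` (units of the matrix ring)
generated by all `H`-gates, `Z`-gates and `CZ`-gates. -/
def GateGroup (n : ℕ) : Subgroup (Mat n)ˣ :=
  Subgroup.closure { U : (Mat n)ˣ | (U : Mat n) ∈ gateSet n }

/-- The extended gate group `G_n'`: the subgroup of `GL(2^n, ℝ)` generated by `−I`
together with all `H`-gates, `Z`-gates and `CZ`-gates. -/
def ExtGateGroup (n : ℕ) : Subgroup (Mat n)ˣ :=
  Subgroup.closure ({ U : (Mat n)ˣ | (U : Mat n) ∈ gateSet n } ∪ {(-1 : (Mat n)ˣ)})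

/-- `Z ⊗ I ⊗ ⋯ ⊗ I` (Z on the first qubit). -/
def firstZ (n : ℕ) : Mat n := tensorN (fun j => if (j : ℕ) = 0 then Z2 else 1)

/-- `I ⊗ ⋯ ⊗ I ⊗ X` (X on the last qubit). -/
def lastX (n : ℕ) : Mat n := tensorN (fun j => if (j : ℕ) = n - 1 then X2 else 1)

/-- `I ⊗ ⋯ ⊗ I ⊗ Z` (Z on the last qubit). -/
def lastZ (n : ℕ) : Mat n := tensorN (fun j => if (j : ℕ) = n - 1 then Z2 else 1)

variable {n : ℕ}

theorem tensorN_mul (P R : Fin n → Matrix (Fin 2) (Fin 2) ℝ) :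
    tensorN P * tensorN R = tensorN (fun i => P i * R i) := by
  ext x y
  simp only [tensorN, Matrix.mul_apply, Matrix.of_apply, ← Finset.prod_mul_distrib]
  rw [Finset.prod_univ_sum, Fintype.piFinset_univ]

theorem tensorN_one : tensorN (fun _ : Fin n => 1) = 1 := by
  ext x y
  by_cases h : x = y
  · subst h; simp [tensorN]
  · obtain ⟨i, hi⟩ := Function.ne_iff.mp h
    rw [Matrix.one_apply_ne h]
    exact Finset.prod_eq_zero (Finset.mem_univ i) (Matrix.one_apply_ne hi)

theorem tensorN_update_apply (P : Fin n → Matrix (Fin 2) (Fin 2) ℝ) (i : Fin n)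
    (A : Matrix (Fin 2) (Fin 2) ℝ) (x y : Fin n → Fin 2) :
    tensorN (Function.update P i A) x y =
      A (x i) (y i) * ∏ k ∈ Finset.univ.erase i, P k (x k) (y k) := by
  rw [tensorN, Matrix.of_apply, ← Finset.mul_prod_erase _ _ (Finset.mem_univ i),
    Function.update_self]
  congr 1
  refine Finset.prod_congr rfl fun k hk => ?_
  rw [Function.update_of_ne (Finset.ne_of_mem_erase hk)]

theorem tensorN_update_smul (P : Fin n → Matrix (Fin 2) (Fin 2) ℝ) (i : Fin n) (c : ℝ)
    (A : Matrix (Fin 2) (Fin 2) ℝ) :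
    tensorN (Function.update P i (c • A)) = c • tensorN (Function.update P i A) := by
  ext x y
  simp [tensorN_update_apply, mul_assoc]

theorem gate1_mul_tensorN_update {i : Fin n} {G A A' : Matrix (Fin 2) (Fin 2) ℝ}
    (h : G * A = A' * G) (P : Fin n → Matrix (Fin 2) (Fin 2) ℝ) :
    gate1 i G * tensorN (Function.update P i A) =
      tensorN (Function.update P i A') * gate1 i G := by
  rw [gate1, tensorN_mul, tensorN_mul]
  congr 1
  funext k
  by_cases hk : k = i
  · subst hk; simpa using h
  · simp [hk]

theorem gate1_mul_self {i : Fin n} {G : Matrix (Fin 2) (Fin 2) ℝ} (h : G * G = 1) :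
    gate1 i G * gate1 i G = 1 := by
  rw [gate1, tensorN_mul, ← tensorN_one]
  congr 1
  funext k
  by_cases hk : k = i <;> simp [hk, h]

theorem CZgate_mul_self (i j : Fin n) : CZgate i j * CZgate i j = 1 := by
  rw [CZgate, Matrix.diagonal_mul_diagonal, ← Matrix.diagonal_one]
  congr 1
  funext x
  split_ifs <;> simp

/-- The diagonal entry of `CZ` at the two-bit state `(a, b)`. -/
def czSign (a b : Fin 2) : ℝ := if a = 1 ∧ b = 1 then -1 else 1

/-- `CZ * (A ⊗ C) = (A' ⊗ C') * CZ`, entrywise. -/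
def CZConj (A C A' C' : Matrix (Fin 2) (Fin 2) ℝ) : Prop :=
  ∀ a b c d, czSign a c * (A a b * C c d) = A' a b * C' c d * czSign b d

/-- The tensor product `P` with the factors at `i` and `j` replaced by `A` and `C`. -/
def twoSite (P : Fin n → Matrix (Fin 2) (Fin 2) ℝ) (i j : Fin n)
    (A C : Matrix (Fin 2) (Fin 2) ℝ) : Mat n :=
  tensorN (Function.update (Function.update P i A) j C)

theorem twoSite_apply (P : Fin n → Matrix (Fin 2) (Fin 2) ℝ) {i j : Fin n} (hij : i ≠ j)
    (A C : Matrix (Fin 2) (Fin 2) ℝ) (x y : Fin n → Fin 2) :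
    twoSite P i j A C x y = A (x i) (y i) * C (x j) (y j) *
      ∏ k ∈ (Finset.univ.erase j).erase i, P k (x k) (y k) := by
  rw [twoSite, tensorN_update_apply,
    ← Finset.mul_prod_erase _ _ (Finset.mem_erase.mpr ⟨hij, Finset.mem_univ i⟩),
    Function.update_self]
  rw [Finset.prod_congr rfl fun k hk => by
    rw [Function.update_of_ne (Finset.ne_of_mem_erase hk)]]
  ring

theorem CZgate_mul_twoSite (P : Fin n → Matrix (Fin 2) (Fin 2) ℝ) {i j : Fin n} (hij : i ≠ j)
    {A C A' C' : Matrix (Fin 2) (Fin 2) ℝ} (h : CZConj A C A' C') :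
    CZgate i j * twoSite P i j A C = twoSite P i j A' C' * CZgate i j := by
  ext x y
  rw [CZgate, Matrix.diagonal_mul, Matrix.mul_diagonal, twoSite_apply P hij,
    twoSite_apply P hij]
  have := h (x i) (y i) (x j) (y j)
  unfold czSign at this
  linear_combination (∏ k ∈ (Finset.univ.erase j).erase i, P k (x k) (y k)) * this

/-- Some element of the gate group conjugates `A` to `A'` and `B` to `B'`. -/
def SimConj (A B A' B' : Mat n) : Prop :=
  ∃ U ∈ GateGroup n, (U : Mat n) * A = A' * U ∧ (U : Mat n) * B = B' * U

theorem SimConj.refl (A B : Mat n) : SimConj A B A B :=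
  ⟨1, one_mem _, by simp, by simp⟩

theorem SimConj.trans {A B A' B' A'' B'' : Mat n} (h : SimConj A B A' B')
    (h' : SimConj A' B' A'' B'') : SimConj A B A'' B'' := by
  obtain ⟨U, hU, hA, hB⟩ := h
  obtain ⟨V, hV, hA', hB'⟩ := h'
  refine ⟨V * U, mul_mem hV hU, ?_, ?_⟩
  · rw [Units.val_mul, mul_assoc, hA, ← mul_assoc, hA', mul_assoc]
  · rw [Units.val_mul, mul_assoc, hB, ← mul_assoc, hB', mul_assoc]

theorem SimConj.of_gate {G A B A' B' : Mat n} (hG : G ∈ gateSet n) (hG2 : G * G = 1)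
    (hA : G * A = A' * G) (hB : G * B = B' * G) : SimConj A B A' B' :=
  ⟨⟨G, G, hG2, hG2⟩, Subgroup.subset_closure hG, hA, hB⟩

theorem SimConj.mul_self_eq_one {A B A' B' : Mat n} (h : SimConj A B A' B')
    (hA : A * A = 1) : A' * A' = 1 := by
  obtain ⟨U, -, h, -⟩ := h
  have : A' * A' * U = U := by rw [mul_assoc, ← h, ← mul_assoc, ← h, mul_assoc, hA, mul_one]
  simpa using congrArg (· * ((U⁻¹ : (Mat n)ˣ) : Mat n)) this

theorem sqrt_two_inv_mul_self : (Real.sqrt 2)⁻¹ * (Real.sqrt 2)⁻¹ = 2⁻¹ := by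
  rw [← mul_inv, Real.mul_self_sqrt (by norm_num)]

theorem Hmat_mul_self : Hmat * Hmat = 1 := by
  rw [Hmat, Matrix.smul_mul, Matrix.mul_smul, smul_smul, sqrt_two_inv_mul_self]
  ext a b
  fin_cases a <;> fin_cases b <;> norm_num [Matrix.mul_apply, Fin.sum_univ_two]

theorem Z2_mul_self : Z2 * Z2 = 1 := by
  ext a b
  fin_cases a <;> fin_cases b <;> simp [Z2]

/-- `c X`. -/
def cX (c : ℝ) : Matrix (Fin 2) (Fin 2) ℝ := !![0, c; c, 0]

/-- `c Z`. -/
def cZ (c : ℝ) : Matrix (Fin 2) (Fin 2) ℝ := !![c, 0; 0, -c]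

/-- `c XZ`. -/
def cXZ (c : ℝ) : Matrix (Fin 2) (Fin 2) ℝ := !![0, -c; c, 0]

/-- `c I`. -/
def cI (c : ℝ) : Matrix (Fin 2) (Fin 2) ℝ := !![c, 0; 0, c]

theorem Hmat_mul_cX (c : ℝ) : Hmat * cX c = cZ c * Hmat := by
  simp [Hmat, cX, cZ, mul_comm]

theorem Hmat_mul_cZ (c : ℝ) : Hmat * cZ c = cX c * Hmat := by
  simp [Hmat, cX, cZ, mul_comm]

theorem Hmat_mul_cXZ (c : ℝ) : Hmat * cXZ c = cXZ (-c) * Hmat := by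
  simp [Hmat, cXZ, mul_comm]

theorem Hmat_mul_cI (c : ℝ) : Hmat * cI c = cI c * Hmat := by
  simp [Hmat, cI, mul_comm]

section TwoSite

variable {P R : Fin n → Matrix (Fin 2) (Fin 2) ℝ} {i j : Fin n}
  {A C B D A' C' B' D' : Matrix (Fin 2) (Fin 2) ℝ}

theorem SimConj.hadamard_right (hC : Hmat * C = C' * Hmat) (hD : Hmat * D = D' * Hmat) :
    SimConj (twoSite P i j A C) (twoSite R i j B D)
      (twoSite P i j A C') (twoSite R i j B D') :=
  .of_gate (Or.inl ⟨j, rfl⟩) (gate1_mul_self Hmat_mul_self)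
    (gate1_mul_tensorN_update hC _) (gate1_mul_tensorN_update hD _)

theorem SimConj.hadamard_left (hij : i ≠ j) (hA : Hmat * A = A' * Hmat)
    (hB : Hmat * B = B' * Hmat) :
    SimConj (twoSite P i j A C) (twoSite R i j B D)
      (twoSite P i j A' C) (twoSite R i j B' D) := by
  simp only [twoSite, Function.update_comm hij]
  exact .of_gate (Or.inl ⟨i, rfl⟩) (gate1_mul_self Hmat_mul_self)
    (gate1_mul_tensorN_update hA _) (gate1_mul_tensorN_update hB _)

theorem SimConj.cz (hj : (j : ℕ) = i + 1) (hA : CZConj A C A' C') (hB : CZConj B D B' D') :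
    SimConj (twoSite P i j A C) (twoSite R i j B D)
      (twoSite P i j A' C') (twoSite R i j B' D') := by
  have hij : i ≠ j := fun h => by simp [h] at hj
  refine .of_gate (Or.inr (Or.inr ⟨i, hj ▸ j.2, ?_⟩)) (CZgate_mul_self i j)
    (CZgate_mul_twoSite _ hij hA) (CZgate_mul_twoSite _ hij hB)
  congr 1
  exact Fin.ext hj

/-- Conjugation by `CZ (H ⊗ H) CZ (H ⊗ H) CZ (H ⊗ I)` moves a factor `c X` to the right. -/
theorem SimConj.swap_cX (hj : (j : ℕ) = i + 1) (c : ℝ) :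
    SimConj (twoSite P i j (cX c) (cI 1)) (twoSite R i j (cZ 1) (cI 1))
      (twoSite P i j (cI 1) (cX c)) (twoSite R i j (cI 1) (cZ 1)) := by
  have hij : i ≠ j := fun h => by simp [h] at hj
  refine (SimConj.hadamard_left hij (Hmat_mul_cX c) (Hmat_mul_cZ 1)).trans ?_
  refine (SimConj.cz hj (A' := cZ c) (C' := cI 1) (B' := cX 1) (D' := cZ 1) ?_ ?_).trans ?_
  rotate_left 2
  refine (SimConj.hadamard_left hij (Hmat_mul_cZ c) (Hmat_mul_cX 1)).trans ?_
  refine (SimConj.hadamard_right (Hmat_mul_cI 1) (Hmat_mul_cZ 1)).trans ?_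
  refine (SimConj.cz hj (A' := cX c) (C' := cZ 1) (B' := cI 1) (D' := cX 1) ?_ ?_).trans ?_
  rotate_left 2
  refine (SimConj.hadamard_left hij (Hmat_mul_cX c) (Hmat_mul_cI 1)).trans ?_
  refine (SimConj.hadamard_right (Hmat_mul_cZ 1) (Hmat_mul_cX 1)).trans ?_
  refine SimConj.cz hj ?_ ?_
  all_goals
    intro a b c d
    fin_cases a <;> fin_cases b <;> fin_cases c <;> fin_cases d <;>
      simp [czSign, cX, cZ, cI]

/-- Conjugation by `CZ (H ⊗ H) CZ (H ⊗ H) CZ (H ⊗ I)` moves a factor `c XZ` to the right. -/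
theorem SimConj.swap_cXZ (hj : (j : ℕ) = i + 1) (c : ℝ) :
    SimConj (twoSite P i j (cXZ c) (cI 1)) (twoSite R i j (cZ 1) (cI 1))
      (twoSite P i j (cI 1) (cXZ c)) (twoSite R i j (cI 1) (cZ 1)) := by
  have hij : i ≠ j := fun h => by simp [h] at hj
  refine (SimConj.hadamard_left hij (Hmat_mul_cXZ c) (Hmat_mul_cZ 1)).trans ?_
  refine (SimConj.cz hj (A' := cXZ (-c)) (C' := cZ 1) (B' := cX 1) (D' := cZ 1) ?_ ?_).trans ?_
  rotate_left 2
  refine (SimConj.hadamard_left hij (Hmat_mul_cXZ (-c)) (Hmat_mul_cX 1)).trans ?_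
  refine (SimConj.hadamard_right (Hmat_mul_cZ 1) (Hmat_mul_cZ 1)).trans ?_
  refine (SimConj.cz hj (A' := cX c) (C' := cXZ (-1)) (B' := cI 1) (D' := cX 1) ?_ ?_).trans ?_
  rotate_left 2
  refine (SimConj.hadamard_left hij (Hmat_mul_cX c) (Hmat_mul_cI 1)).trans ?_
  refine (SimConj.hadamard_right (Hmat_mul_cXZ (-1)) (Hmat_mul_cX 1)).trans ?_
  refine SimConj.cz hj ?_ ?_
  all_goals
    intro a b c d
    fin_cases a <;> fin_cases b <;> fin_cases c <;> fin_cases d <;>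
      simp [czSign, cX, cZ, cI, cXZ]

/-- A nonscalar factor at the qubit `i + 1` can be cleared, keeping `Z` at the qubit `i`. -/
theorem SimConj.clear_right (hj : (j : ℕ) = i + 1) {c : ℝ}
    (hA : A = cX c ∨ A = cXZ c) (hC : C ∈ pauliSet) :
    ∃ c' A', (A' = cX c' ∨ A' = cXZ c') ∧
      SimConj (twoSite P i j A C) (twoSite R i j (cZ 1) (cI 1))
        (twoSite P i j A' (cI 1)) (twoSite R i j (cZ 1) (cI 1)) := by
  have hZ : ∀ (c : ℝ) (A), (A = cX c ∨ A = cXZ c) →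
      SimConj (twoSite P i j A (cZ 1)) (twoSite R i j (cZ 1) (cI 1))
        (twoSite P i j A (cI 1)) (twoSite R i j (cZ 1) (cI 1)) := by
    rintro c A (rfl | rfl) <;> refine SimConj.cz hj ?_ ?_ <;> intro a b c d <;>
      fin_cases a <;> fin_cases b <;> fin_cases c <;> fin_cases d <;>
      simp [czSign, cX, cZ, cI, cXZ]
  have hX : ∀ (c : ℝ) (A), (A = cX c ∨ A = cXZ c) →
      SimConj (twoSite P i j A (cX 1)) (twoSite R i j (cZ 1) (cI 1))
        (twoSite P i j A (cI 1)) (twoSite R i j (cZ 1) (cI 1)) := fun c A h =>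
    (SimConj.hadamard_right (Hmat_mul_cX 1) (Hmat_mul_cI 1)).trans (hZ c A h)
  have hXZ : C = cXZ 1 → ∃ c' A', (A' = cX c' ∨ A' = cXZ c') ∧
      SimConj (twoSite P i j A C) (twoSite R i j (cZ 1) (cI 1))
        (twoSite P i j A' (cX 1)) (twoSite R i j (cZ 1) (cI 1)) := by
    rintro rfl
    obtain rfl | rfl := hA
    · refine ⟨-c, cXZ (-c), Or.inr rfl, SimConj.cz hj ?_ ?_⟩ <;> intro a b c d <;>
        fin_cases a <;> fin_cases b <;> fin_cases c <;> fin_cases d <;>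
        simp [czSign, cX, cZ, cI, cXZ]
    · refine ⟨-c, cX (-c), Or.inl rfl, SimConj.cz hj ?_ ?_⟩ <;> intro a b c d <;>
        fin_cases a <;> fin_cases b <;> fin_cases c <;> fin_cases d <;>
        simp [czSign, cX, cZ, cI, cXZ]
  obtain h | h | h | h := hC
  · have h1 : C = cI 1 := by rw [h, cI, Matrix.one_fin_two]
    exact ⟨c, A, hA, h1 ▸ .refl _ _⟩
  · exact ⟨c, A, hA, (show C = cX 1 from h) ▸ hX c A hA⟩
  · exact ⟨c, A, hA, (show C = cZ 1 from h) ▸ hZ c A hA⟩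
  · have h1 : C = cXZ 1 := by
      rw [h]
      simp [X2, Z2, cXZ]
    obtain ⟨c', A', hA', hs⟩ := hXZ h1
    exact ⟨c', A', hA', hs.trans (hX c' A' hA')⟩

end TwoSite

theorem cI_one : cI 1 = 1 := by rw [cI, Matrix.one_fin_two]

theorem tensorN_update_one_last (l : Fin n) (hl : (l : ℕ) = n - 1)
    (A : Matrix (Fin 2) (Fin 2) ℝ) :
    tensorN (fun j : Fin n => if (j : ℕ) = n - 1 then A else 1) =
      tensorN (Function.update 1 l A) := by
  congr 1
  funext k
  by_cases hk : k = l
  · subst hk; simp [hl]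
  · have : (k : ℕ) ≠ n - 1 := fun h => hk (Fin.ext (h.trans hl.symm))
    simp [hk, this]

/-- A multiple of `X` or `XZ` on the last qubit that squares to `1` is `X` up to a `Z`-gate. -/
theorem simConj_lastX (l : Fin n) (hl : (l : ℕ) = n - 1) {c : ℝ}
    {A : Matrix (Fin 2) (Fin 2) ℝ} (hA : A = cX c ∨ A = cXZ c)
    (hsq : tensorN (Function.update 1 l A) * tensorN (Function.update 1 l A) = 1) :
    SimConj (tensorN (Function.update 1 l A)) (tensorN (Function.update 1 l (cZ 1)))
      (lastX n) (lastZ n) := by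
  have hA2 : A * A = 1 := by
    ext a b
    have := congrFun₂ hsq (Function.update 0 l a) (Function.update 0 l b)
    have hf : (fun i => Function.update (1 : Fin n → Matrix (Fin 2) (Fin 2) ℝ) l A i *
        Function.update (1 : Fin n → Matrix (Fin 2) (Fin 2) ℝ) l A i) =
        Function.update (1 : Fin n → Matrix (Fin 2) (Fin 2) ℝ) l (A * A) := by
      funext k
      by_cases hk : k = l
      · subst hk; simp
      · simp [hk]
    rw [tensorN_mul, hf, tensorN_update_apply, Finset.prod_eq_one] at this
    · simpa [Matrix.one_apply, (Function.update_injective _ l).eq_iff] using this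
    · intro k hk
      rw [Function.update_of_ne (Finset.ne_of_mem_erase hk),
        Function.update_of_ne (Finset.ne_of_mem_erase hk)]
      rfl
  rw [lastX, lastZ, tensorN_update_one_last l hl, tensorN_update_one_last l hl]
  have h00 := congrFun₂ hA2 0 0
  obtain rfl | rfl := hA
  · simp only [cX, Matrix.mul_apply, Fin.sum_univ_two] at h00
    obtain rfl | rfl : c = 1 ∨ c = -1 := mul_self_eq_one_iff.mp (by simpa using h00)
    · exact .refl _ _
    · refine .of_gate (Or.inr (Or.inl ⟨l, rfl⟩)) (gate1_mul_self Z2_mul_self)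
        (gate1_mul_tensorN_update ?_ _) (gate1_mul_tensorN_update ?_ _) <;>
      simp [cX, cZ, X2, Z2]
  · simp only [cXZ, Matrix.mul_apply, Fin.sum_univ_two] at h00
    simp at h00
    nlinarith [mul_self_nonneg c]

theorem twoSite_one_left_update (P : Fin n → Matrix (Fin 2) (Fin 2) ℝ) {i : Fin n}
    (j : Fin n) (A : Matrix (Fin 2) (Fin 2) ℝ) (hP : P i = 1) :
    twoSite P i j 1 A = tensorN (Function.update P j A) := by
  rw [twoSite, ← hP, Function.update_eq_self]

theorem simConj_last_of_leading (m : ℕ) (i l : Fin n) (hl : (l : ℕ) = n - 1)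
    (him : (i : ℕ) + m = l) (P : Fin n → Matrix (Fin 2) (Fin 2) ℝ) (c : ℝ)
    (hlt : ∀ k < i, P k = 1) (hi : P i = cX c ∨ P i = cXZ c) (hgt : ∀ k, i < k → P k ∈ pauliSet)
    (hsq : tensorN P * tensorN P = 1) :
    SimConj (tensorN P) (tensorN (Function.update 1 i (cZ 1))) (lastX n) (lastZ n) := by
  induction m generalizing i P c with
  | zero =>
    obtain rfl : i = l := Fin.ext him
    have hP : P = Function.update (1 : Fin n → Matrix (Fin 2) (Fin 2) ℝ) i (P i) := by
      refine Function.eq_update_iff.mpr ⟨rfl, fun k hk => hlt k ?_⟩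
      have := k.2
      have : (k : ℕ) ≠ i := fun h => hk (Fin.ext h)
      exact Fin.lt_def.mpr (by omega)
    generalize P i = A at hP hi
    subst hP
    exact simConj_lastX i hl hi hsq
  | succ m ih =>
    have hlt' := l.2
    obtain ⟨j, hj⟩ : ∃ j : Fin n, (j : ℕ) = i + 1 := ⟨⟨i + 1, by omega⟩, rfl⟩
    have hij : i ≠ j := fun h => by simp [h] at hj
    obtain ⟨c', A', hA', hs⟩ := SimConj.clear_right (P := P) (R := 1) hj hi
      (hgt j (Fin.lt_def.mpr (by omega)))
    have hswap : SimConj (twoSite P i j A' (cI 1)) (twoSite 1 i j (cZ 1) (cI 1))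
        (twoSite P i j (cI 1) A') (twoSite 1 i j (cI 1) (cZ 1)) := by
      obtain rfl | rfl := hA'
      · exact .swap_cX hj c'
      · exact .swap_cXZ hj c'
    have hs' := hs.trans hswap
    have hstart : twoSite P i j (P i) (P j) = tensorN P := by simp [twoSite]
    have hZ : twoSite 1 i j (cZ 1) (cI 1) = tensorN (Function.update 1 i (cZ 1)) := by
      rw [twoSite, cI_one]
      congr 1
      exact Function.update_eq_self_iff.mpr (by simp [hij.symm])
    have hZ' : twoSite 1 i j (cI 1) (cZ 1) = tensorN (Function.update 1 j (cZ 1)) := by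
      rw [cI_one, twoSite_one_left_update 1 j _ rfl]
    rw [hstart, hZ, hZ'] at hs'
    refine hs'.trans (ih j (by omega) _ c' ?_ ?_ ?_ (hs'.mul_self_eq_one hsq))
    · intro k hk
      rw [Function.update_of_ne hk.ne, cI_one]
      by_cases hki : k = i
      · simp [hki]
      · rw [Function.update_of_ne hki]
        have : (k : ℕ) ≠ i := fun h => hki (Fin.ext h)
        have := Fin.lt_def.mp hk
        exact hlt k (Fin.lt_def.mpr (by omega))
    · simpa using hA'
    · intro k hk
      have hk' := Fin.lt_def.mp hk
      have hik : i < k := Fin.lt_def.mpr (by omega)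
      rw [Function.update_of_ne hk.ne', Function.update_of_ne hik.ne']
      exact hgt k hik

theorem firstZ_eq (i : Fin n) (hi : (i : ℕ) = 0) :
    firstZ n = tensorN (Function.update 1 i Z2) := by
  rw [firstZ]
  congr 1
  funext k
  by_cases hk : k = i
  · subst hk; simp [hi]
  · have : (k : ℕ) ≠ 0 := fun h => hk (Fin.ext (h.trans hi.symm))
    simp [hk, this]

/-- A tensor product anticommuting with `Z` on a qubit does not commute with it there. -/
theorem not_commute_of_anticommute {P : Fin n → Matrix (Fin 2) (Fin 2) ℝ} {i : Fin n}
    (hi : (i : ℕ) = 0) {Q : Mat n} {s : ℝ} (hQ : Q = s • tensorN P) (hQ2 : Q * Q = 1)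
    (hanti : Q * firstZ n = -(firstZ n * Q)) : P i * Z2 ≠ Z2 * P i := by
  intro h
  have hZ2 : firstZ n * firstZ n = 1 := by
    rw [firstZ, tensorN_mul, ← tensorN_one]
    congr 1
    funext k
    split_ifs <;> simp [Z2_mul_self]
  have hcomm : Q * firstZ n = firstZ n * Q := by
    rw [hQ, Matrix.smul_mul, Matrix.mul_smul, firstZ_eq i hi, tensorN_mul, tensorN_mul]
    congr 2
    funext k
    by_cases hk : k = i
    · subst hk; simpa using h
    · simp [hk]
  have h0 : Q * firstZ n = 0 := by
    ext x y
    exact self_eq_neg.mp (congrFun₂ (hanti.trans (congrArg _ hcomm.symm)) x y)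
  have hQ0 : Q = 0 := by
    rw [← mul_one Q, ← hZ2, ← mul_assoc, h0, zero_mul]
  rw [hQ0, zero_mul] at hQ2
  exact zero_ne_one hQ2

/-- For `n ≥ 1` and `Q ∈ P_n` with `Q² = I` anticommuting with
`Z ⊗ I^{⊗(n−1)}`, there is `U` in the gate group `G_n` with
`U Q U⁻¹ = I ⊗ ⋯ ⊗ I ⊗ X` and `U (Z ⊗ I^{⊗(n−1)}) U⁻¹ = I ⊗ ⋯ ⊗ I ⊗ Z`. -/
theorem exists_gate_conj_to_lastX (n : ℕ) (hn : 1 ≤ n) (Q : Mat n)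
    (hQ : Q ∈ PauliGroup n) (hQ2 : Q * Q = 1)
    (hanti : Q * firstZ n = -(firstZ n * Q)) :
    ∃ U ∈ GateGroup n,
      (U : Mat n) * Q * ((U⁻¹ : (Mat n)ˣ) : Mat n) = lastX n ∧
      (U : Mat n) * firstZ n * ((U⁻¹ : (Mat n)ˣ) : Mat n) = lastZ n := by
  obtain ⟨a, P, hP, rfl⟩ := hQ
  obtain ⟨i, hi⟩ : ∃ i : Fin n, (i : ℕ) = 0 := ⟨⟨0, hn⟩, rfl⟩
  have hne := not_commute_of_anticommute hi rfl hQ2 hanti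
  set s : ℝ := (-1) ^ (a : ℕ)
  have hsP : s • tensorN P = tensorN (Function.update P i (s • P i)) := by
    rw [tensorN_update_smul, Function.update_eq_self]
  have hPi : s • P i = cX s ∨ s • P i = cXZ s := by
    obtain h | h | h | h := hP i
    · exact absurd (by simp [h]) hne
    · left; simp [h, X2, cX]
    · exact absurd (by rw [show P i = Z2 from h]) hne
    · right; rw [show P i = X2 * Z2 from h]; simp [X2, Z2, cXZ]
  rw [hsP] at hQ2 ⊢
  obtain ⟨U, hU, hX, hZ⟩ := simConj_last_of_leading (n - 1) i ⟨n - 1, by omega⟩ rfl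
    (by simp [hi]) (Function.update P i (s • P i)) s
    (fun k hk => absurd (Fin.lt_def.mp hk) (by omega)) (by simpa using hPi)
    (fun k hk => by rw [Function.update_of_ne hk.ne']; exact hP k) hQ2
  rw [← show Z2 = cZ 1 from rfl, ← firstZ_eq i hi] at hZ
  exact ⟨U, hU, by rw [hX, Units.mul_inv_cancel_right], by rw [hZ, Units.mul_inv_cancel_right]⟩

end RealStab

end
end
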